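/- arXiv:math/0302223 — 2 statements merged into one kernel-verified Lean document; each statement's English description precedes it below -/
import Mathlib

section
/- Let R be an integral domain in which every nonzero strong ideal is a radical ideal (i.e., R is an RTP-domain) and which satisfies the ascending chain condition on radical ideals. If R has no strongly divisorial prime ideals, then R is completely integrally closed. -/
/-! Basic notions: for an integral domain `R` with fraction field `K`, an ideal `I`
is viewed as the submodule `idealToFrac R I` of `K`; `1 / M` is the Mathlib
submodule quotient `(R : M) = {x ∈ K | x M ⊆ R}` and `M / N = {x ∈ K | x N ⊆ M}`. -/

variable (R : Type*) [CommRing R] [IsDomain R]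

/-- The image of an ideal of `R` in the fraction field, as an `R`-submodule. -/
def idealToFrac (I : Ideal R) : Submodule R (FractionRing R) :=
  Submodule.map (Algebra.linearMap R (FractionRing R)) I

/-- An ideal `I` is strong if `(R : I) = (I : I)`. -/
def IsStrong (I : Ideal R) : Prop :=
  1 / idealToFrac R I = idealToFrac R I / idealToFrac R I

/-- An ideal `I` is divisorial if `(R : (R : I)) = I`. -/
def IsDivisorial (I : Ideal R) : Prop :=
  1 / (1 / idealToFrac R I) = idealToFrac R I

/-- `R` is seminormal if every `x ∈ K` with `x², x³ ∈ R` lies in `R`. -/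
def Seminormal : Prop :=
  ∀ x : FractionRing R,
    x ^ 2 ∈ (algebraMap R (FractionRing R)).range →
    x ^ 3 ∈ (algebraMap R (FractionRing R)).range →
    x ∈ (algebraMap R (FractionRing R)).range

/-- `R` is completely integrally closed if every almost integral element of `K` lies in `R`. -/
def CompletelyIntegrallyClosed : Prop :=
  ∀ x : FractionRing R,
    (∃ d : R, d ≠ 0 ∧
      ∀ n : ℕ, algebraMap R (FractionRing R) d * x ^ n ∈ (algebraMap R (FractionRing R)).range) →
    x ∈ (algebraMap R (FractionRing R)).range

/-- The `v`-operation `M ↦ (R : (R : M))` on submodules of the fraction field. -/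
def vOp (M : Submodule R (FractionRing R)) : Submodule R (FractionRing R) :=
  1 / (1 / M)

/-- The `t`-closure `M_t = ⋃ J_v`, the union over finitely generated `J ⊆ M`. -/
def tClosure (M : Submodule R (FractionRing R)) : Submodule R (FractionRing R) :=
  ⨆ (J : Submodule R (FractionRing R)) (_ : J.FG) (_ : J ≤ M), vOp R J

/-- An ideal `I` is a `t`-ideal if `I_t = I`. -/
def IsTIdeal (I : Ideal R) : Prop :=
  tClosure R (idealToFrac R I) = idealToFrac R I

/-- A maximal `t`-ideal is an ideal maximal among the proper integral `t`-ideals. -/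
def IsMaximalTIdeal (I : Ideal R) : Prop :=
  I ≠ ⊤ ∧ IsTIdeal R I ∧ ∀ J : Ideal R, J ≠ ⊤ → IsTIdeal R J → I ≤ J → J = I

/-- An ideal `I` is `t`-invertible if `(I (R : I))_t = R`. -/
def IsTInvertible (I : Ideal R) : Prop :=
  tClosure R (idealToFrac R I * (1 / idealToFrac R I)) = 1

/-- An ideal `I` is invertible if `I (R : I) = R`. -/
def IsInvertibleIdeal (I : Ideal R) : Prop :=
  idealToFrac R I * (1 / idealToFrac R I) = 1

theorem mem_inv_aux {R : Type*} [CommRing R] [IsDomain R] (I : Ideal R) (y : FractionRing R) :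
    y ∈ 1 / idealToFrac R I ↔
      ∀ r ∈ I, ∃ s : R, algebraMap R (FractionRing R) s = y * algebraMap R (FractionRing R) r := by
  simp only [Submodule.mem_div_iff_forall_mul_mem, idealToFrac, Submodule.mem_map,
    Algebra.linearMap_apply, Submodule.mem_one, forall_exists_index, and_imp,
    forall_apply_eq_imp_iff₂]

theorem isStrong_aux {R : Type*} [CommRing R] [IsDomain R] (I : Ideal R) :
    IsStrong R I ↔ ∀ y ∈ 1 / idealToFrac R I, ∀ r ∈ I, ∃ s ∈ I,
      algebraMap R (FractionRing R) s = y * algebraMap R (FractionRing R) r := by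
  have key : ∀ y, y ∈ idealToFrac R I / idealToFrac R I ↔ ∀ r ∈ I, ∃ s ∈ I,
      algebraMap R (FractionRing R) s = y * algebraMap R (FractionRing R) r := by
    intro y
    simp only [Submodule.mem_div_iff_forall_mul_mem, idealToFrac, Submodule.mem_map,
      Algebra.linearMap_apply, forall_exists_index, and_imp, forall_apply_eq_imp_iff₂]
  constructor
  · intro h y hy
    rw [h] at hy
    exact (key y).1 hy
  · intro h
    refine le_antisymm (fun y hy => (key y).2 (h y hy)) (fun y hy => ?_)
    rw [mem_inv_aux]
    intro r hr
    obtain ⟨s, _, hs⟩ := (key y).1 hy r hr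
    exact ⟨s, hs⟩

theorem isDivisorial_aux {R : Type*} [CommRing R] [IsDomain R] (I : Ideal R) :
    IsDivisorial R I ↔ ∀ z : R, (∀ w ∈ 1 / idealToFrac R I, ∃ s : R,
      algebraMap R (FractionRing R) s = algebraMap R (FractionRing R) z * w) → z ∈ I := by
  constructor
  · intro h z hz
    have : algebraMap R (FractionRing R) z ∈ 1 / (1 / idealToFrac R I) := by
      rw [Submodule.mem_div_iff_forall_mul_mem]
      intro w hw
      rw [Submodule.mem_one]
      exact hz w hw
    rw [h] at this
    obtain ⟨r, hr, hrz⟩ := this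
    rwa [← IsFractionRing.injective R (FractionRing R) hrz]
  · intro h
    refine le_antisymm (fun z hz => ?_) ?_
    · rw [Submodule.mem_div_iff_forall_mul_mem] at hz
      simp only [Submodule.mem_one] at hz
      obtain ⟨r, hr⟩ := hz 1 ((mem_inv_aux I 1).2 fun r _ => ⟨r, by simp⟩)
      rw [mul_one] at hr
      subst hr
      exact ⟨r, h r hz, rfl⟩
    · rintro _ ⟨r, hr, rfl⟩
      rw [Submodule.mem_div_iff_forall_mul_mem]
      intro w hw
      obtain ⟨s, hs⟩ := (mem_inv_aux I w).1 hw r hr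
      rw [Submodule.mem_one]
      exact ⟨s, by rw [hs, mul_comm]; rfl⟩

/-- the conductor of `R[x]` in `R` -/
def condIdeal {R : Type*} [CommRing R] [IsDomain R] (x : FractionRing R) : Ideal R where
  carrier := {r | ∀ n : ℕ, ∃ s : R,
    algebraMap R (FractionRing R) s = algebraMap R (FractionRing R) r * x ^ n}
  zero_mem' := fun n => ⟨0, by simp⟩
  add_mem' := by
    intro a b ha hb n
    obtain ⟨s, hs⟩ := ha n
    obtain ⟨t, ht⟩ := hb n
    exact ⟨s + t, by rw [map_add, map_add, hs, ht, add_mul]⟩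
  smul_mem' := by
    intro c a ha n
    obtain ⟨s, hs⟩ := ha n
    exact ⟨c * s, by rw [smul_eq_mul, map_mul, map_mul, hs, mul_assoc]⟩

theorem mem_condIdeal {R : Type*} [CommRing R] [IsDomain R] (x : FractionRing R) (r : R) :
    r ∈ condIdeal x ↔ ∀ n : ℕ, ∃ s : R,
      algebraMap R (FractionRing R) s = algebraMap R (FractionRing R) r * x ^ n := Iff.rfl

theorem condIdeal_strong {R : Type*} [CommRing R] [IsDomain R] (x : FractionRing R) :
    IsStrong R (condIdeal x) := by
  rw [isStrong_aux]
  intro y hy r hr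
  rw [mem_inv_aux] at hy
  obtain ⟨s, hs⟩ := hy r hr
  refine ⟨s, fun n => ?_, hs⟩
  obtain ⟨r', hr'⟩ := hr n
  have hm : r' ∈ condIdeal x := by
    intro m
    obtain ⟨t, ht⟩ := hr (n + m)
    exact ⟨t, by rw [ht, hr', pow_add, mul_assoc]⟩
  obtain ⟨t, ht⟩ := hy r' hm
  exact ⟨t, by rw [ht, hs, hr', mul_assoc]⟩

theorem condIdeal_divisorial {R : Type*} [CommRing R] [IsDomain R] (x : FractionRing R) :
    IsDivisorial R (condIdeal x) := by
  rw [isDivisorial_aux]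
  intro z hz n
  refine hz (x ^ n) ((mem_inv_aux _ _).2 fun r hr => ?_)
  obtain ⟨s, hs⟩ := hr n
  exact ⟨s, by rw [hs, mul_comm]⟩

/-- the colon ideal `(M : a)` -/
def colIdeal {R : Type*} [CommRing R] (M : Ideal R) (a : R) : Ideal R where
  carrier := {r | r * a ∈ M}
  zero_mem' := by simp
  add_mem' := by
    intro b c hb hc
    simp only [Set.mem_setOf_eq, add_mul] at *
    exact M.add_mem hb hc
  smul_mem' := by
    intro c b hb
    simp only [Set.mem_setOf_eq, smul_eq_mul, mul_assoc] at *
    exact M.mul_mem_left c hb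

theorem le_colIdeal {R : Type*} [CommRing R] (M : Ideal R) (a : R) : M ≤ colIdeal M a :=
  fun _ hr => M.mul_mem_right a hr

theorem colIdeal_strong {R : Type*} [CommRing R] [IsDomain R] (M : Ideal R) (a : R)
    (h : IsStrong R M) : IsStrong R (colIdeal M a) := by
  rw [isStrong_aux] at h ⊢
  intro y hy r hr
  rw [mem_inv_aux] at hy
  obtain ⟨s, hs⟩ := hy r hr
  obtain ⟨t, htM, ht⟩ := h y ((mem_inv_aux _ _).2 fun r hr => hy r (le_colIdeal M a hr)) (r * a) hr
  refine ⟨s, ?_, hs⟩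
  have : s * a = t := by
    apply IsFractionRing.injective R (FractionRing R)
    rw [ht, map_mul, map_mul, hs, mul_assoc]
  change s * a ∈ M
  rwa [this]

theorem colIdeal_divisorial {R : Type*} [CommRing R] [IsDomain R] (M : Ideal R) (a : R)
    (h : IsDivisorial R M) : IsDivisorial R (colIdeal M a) := by
  rw [isDivisorial_aux] at h ⊢
  intro z hz
  refine h (z * a) fun w hw => ?_
  rw [mem_inv_aux] at hw
  obtain ⟨s, hs⟩ := hz (w * algebraMap R (FractionRing R) a) ((mem_inv_aux _ _).2 fun r hr => by
    obtain ⟨t, ht⟩ := hw (r * a) hr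
    exact ⟨t, by rw [ht, map_mul]; ring⟩)
  exact ⟨s, by rw [hs, map_mul]; ring⟩

/-- Let `R` be an RTP-domain (every nonzero strong ideal is radical) satisfying the
ascending chain condition on radical ideals. If `R` has no strongly divisorial prime
ideals, then `R` is completely integrally closed. -/
theorem rtp_acc_radical_cic {R : Type*} [CommRing R] [IsDomain R]
    (hrtp : ∀ I : Ideal R, I ≠ ⊥ → IsStrong R I → I.IsRadical)
    (hacc : ∀ f : ℕ →o Ideal R, (∀ n, (f n).IsRadical) → ∃ n, ∀ m, n ≤ m → f m = f n)
    (hnosd : ¬ ∃ P : Ideal R, P.IsPrime ∧ P ≠ ⊥ ∧ IsStrong R P ∧ IsDivisorial R P) :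
    CompletelyIntegrallyClosed R := by
  intro x ⟨d, hd, hdx⟩
  by_contra hx
  have hwf : WellFoundedGT {I : Ideal R // I.IsRadical} := by
    rw [wellFoundedGT_iff_monotone_chain_condition]
    intro f
    obtain ⟨n, hn⟩ := hacc ⟨fun n => (f n).1, fun _ _ h => f.monotone h⟩ (fun n => (f n).2)
    exact ⟨n, fun m hm => Subtype.ext (hn m hm).symm⟩
  have hd' : d ∈ condIdeal x := fun n => hdx n
  have hne : condIdeal x ≠ ⊥ := fun h => hd (by rw [h] at hd'; simpa using hd')
  let S : Set {I : Ideal R // I.IsRadical} :=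
    {I | I.1 ≠ ⊥ ∧ I.1 ≠ ⊤ ∧ IsStrong R I.1 ∧ IsDivisorial R I.1}
  have hS : S.Nonempty := by
    refine ⟨⟨condIdeal x, hrtp _ hne (condIdeal_strong x)⟩, hne, fun h => hx ?_,
      condIdeal_strong x, condIdeal_divisorial x⟩
    have h1 : (1 : R) ∈ condIdeal x := by
      change condIdeal x = ⊤ at h
      rw [h]; trivial
    obtain ⟨s, hs⟩ := h1 1
    exact ⟨s, by simpa using hs⟩
  obtain ⟨M, ⟨hM0, hM1, hMs, hMd⟩, hmax⟩ := hwf.wf.has_min S hS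
  refine hnosd ⟨M.1, ⟨hM1, ?_⟩, hM0, hMs, hMd⟩
  intro b a hab
  by_contra! hcon
  obtain ⟨hb, ha⟩ := hcon
  have hle := le_colIdeal M.1 a
  have hN0 : colIdeal M.1 a ≠ ⊥ := fun h => hM0 (le_bot_iff.1 (h ▸ hle))
  have hNs := colIdeal_strong M.1 a hMs
  refine hmax ⟨colIdeal M.1 a, hrtp _ hN0 hNs⟩
    ⟨hN0, fun h => ha ?_, hNs, colIdeal_divisorial M.1 a hMd⟩ ?_
  · have h1 : (1 : R) ∈ colIdeal M.1 a := by
      change colIdeal M.1 a = ⊤ at h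
      rw [h]; trivial
    change 1 * a ∈ M.1 at h1
    rwa [one_mul] at h1
  · change M.1 < colIdeal M.1 a
    exact lt_of_le_of_ne hle fun h => hb (by rw [h]; exact hab)
end

section
/- There exists an integral domain R that is not completely integrally closed and has no strongly divisorial prime ideals; moreover, R can be chosen to be quasilocal and one-dimensional with its maximal ideal not divisorial. -/
/-! Basic notions: for an integral domain `R` with fraction field `K`, an ideal `I`
is viewed as the submodule `idealToFrac R I` of `K`; `1 / M` is the Mathlib
submodule quotient `(R : M) = {x ∈ K | x M ⊆ R}` and `M / N = {x ∈ K | x N ⊆ M}`. -/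

variable (R : Type*) [CommRing R] [IsDomain R]

namespace SDEx

/-- The field of Hahn series with rational exponents and complex coefficients. -/
abbrev L : Type := HahnSeries ℚ ℂ

/-- Series with nonnegative support whose coefficients at exponents `< 1` are real. -/
noncomputable def A : Subring L where
  carrier := {f | (∀ q < 0, f.coeff q = 0) ∧ ∀ q < 1, (f.coeff q).im = 0}
  zero_mem' := by simp
  one_mem' := by
    refine ⟨fun q hq => ?_, fun q _ => ?_⟩
    · rw [HahnSeries.coeff_one, if_neg hq.ne]
    · rw [HahnSeries.coeff_one]; split_ifs <;> simp
  add_mem' := by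
    rintro f g ⟨hf, hf'⟩ ⟨hg, hg'⟩
    refine ⟨fun q hq => ?_, fun q hq => ?_⟩
    · simp [hf q hq, hg q hq]
    · simp [hf' q hq, hg' q hq]
  neg_mem' := by
    rintro f ⟨hf, hf'⟩
    refine ⟨fun q hq => ?_, fun q hq => ?_⟩
    · simp [hf q hq]
    · simp [hf' q hq]
  mul_mem' := by
    rintro f g ⟨hf, hf'⟩ ⟨hg, hg'⟩
    refine ⟨fun q hq => ?_, fun q hq => ?_⟩
    · rw [HahnSeries.coeff_mul]
      refine Finset.sum_eq_zero fun ij hij => ?_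
      have h := (Finset.mem_antidiagonal.mp hij).2.2
      by_cases h1 : ij.1 < 0
      · simp [hf _ h1]
      · have h2 : ij.2 < 0 := by linarith
        simp [hg _ h2]
    · rw [HahnSeries.coeff_mul, Complex.im_sum]
      refine Finset.sum_eq_zero fun ij hij => ?_
      have h := (Finset.mem_antidiagonal.mp hij).2.2
      by_cases h1 : ij.1 < 0
      · simp [hf _ h1]
      by_cases h2 : ij.2 < 0
      · simp [hg _ h2]
      have h3 : ij.1 < 1 := by linarith
      have h4 : ij.2 < 1 := by linarith
      simp [hf' _ h3, hg' _ h4]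

theorem mem_A {f : L} :
    f ∈ A ↔ (∀ q < 0, f.coeff q = 0) ∧ ∀ q < 1, (f.coeff q).im = 0 := Iff.rfl

theorem mem_of_order {f : L} (h : 1 ≤ f.order) : f ∈ A := by
  refine ⟨fun q hq => ?_, fun q hq => ?_⟩
  · exact HahnSeries.coeff_eq_zero_of_lt_order (by linarith)
  · rw [HahnSeries.coeff_eq_zero_of_lt_order (by linarith)]; simp

theorem single_mem {e : ℚ} (he : 0 ≤ e) : (HahnSeries.single e (1 : ℂ) : L) ∈ A := by
  refine ⟨fun q hq => ?_, fun q _ => ?_⟩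
  · rw [HahnSeries.coeff_single_of_ne (by linarith)]
  · rw [HahnSeries.coeff_single]; split_ifs <;> simp

theorem order_pow' {m : L} (hm : m ≠ 0) (n : ℕ) : (m ^ n).order = n * m.order := by
  induction n with
  | zero => simp
  | succ k ih =>
    rw [pow_succ, HahnSeries.order_mul (pow_ne_zero _ hm) hm, ih]; push_cast; ring

theorem dvd_iff {r s : A} (hs : s ≠ 0) : s ∣ r ↔ (r : L) / (s : L) ∈ A := by
  have hs' : (s : L) ≠ 0 := fun h => hs (Subtype.ext h)
  constructor
  · rintro ⟨c, rfl⟩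
    have : ((s * c : A) : L) / s = c := by
      push_cast; field_simp
    rw [this]; exact c.2
  · intro h
    refine ⟨⟨_, h⟩, Subtype.ext ?_⟩
    push_cast; field_simp

theorem dvd_pow_of_coeff {m d : A} (hm : (m : L).coeff 0 = 0) (hd : d ≠ 0) :
    ∃ n : ℕ, d ∣ m ^ n := by
  by_cases h0 : m = 0
  · exact ⟨1, by simp [h0]⟩
  have h0' : (m : L) ≠ 0 := fun h => h0 (Subtype.ext h)
  have hd' : (d : L) ≠ 0 := fun h => hd (Subtype.ext h)
  have hpos : 0 < (m : L).order := by
    by_contra hle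
    have hne : (m : L).coeff (m : L).order ≠ 0 := fun h =>
      h0' (HahnSeries.coeff_order_eq_zero.mp h)
    rcases lt_or_eq_of_le (not_lt.mp hle) with h | h
    · exact hne (m.2.1 _ h)
    · rw [h] at hne; exact hne hm
  obtain ⟨n, hn⟩ := exists_nat_ge ((1 + (d : L).order) / (m : L).order)
  refine ⟨n, (dvd_iff hd).mpr (mem_of_order ?_)⟩
  have hq : (((m ^ n : A) : L) / d) * d = (m : L) ^ n := by
    push_cast; field_simp
  have hne : (((m ^ n : A) : L) / d) ≠ 0 := by
    push_cast; exact div_ne_zero (pow_ne_zero _ h0') hd'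
  have := congrArg HahnSeries.order hq
  rw [HahnSeries.order_mul hne hd', order_pow' h0'] at this
  rw [div_le_iff₀ hpos] at hn
  linarith

theorem C_mem (a : ℝ) : (HahnSeries.C (a : ℂ) : L) ∈ A := by
  refine ⟨fun q hq => ?_, fun q _ => ?_⟩
  · rw [HahnSeries.C_apply, HahnSeries.coeff_single_of_ne hq.ne]
  · rw [HahnSeries.C_apply, HahnSeries.coeff_single]; split_ifs <;> simp

theorem isUnit_of_coeff {f : A} (hf : (f : L).coeff 0 ≠ 0) : IsUnit f := by
  have hf0 : f ≠ 0 := by rintro rfl; simp at hf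
  set a : ℝ := ((f : L).coeff 0).re with ha
  have hfa : (f : L).coeff 0 = (a : ℂ) := by
    apply Complex.ext
    · simp [ha]
    · simpa using f.2.2 0 one_pos
  have ha0 : a ≠ 0 := by
    intro h; rw [hfa, h] at hf; simp at hf
  let c : A := ⟨HahnSeries.C (a : ℂ), C_mem a⟩
  have hc : IsUnit c := by
    refine IsUnit.of_mul_eq_one ⟨HahnSeries.C ((a⁻¹ : ℝ) : ℂ), C_mem _⟩ (Subtype.ext ?_)
    change HahnSeries.C (a : ℂ) * HahnSeries.C ((a⁻¹ : ℝ) : ℂ) = (1 : L)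
    rw [← map_mul, ← Complex.ofReal_mul, mul_inv_cancel₀ ha0]; simp
  have hm : ((c - f : A) : L).coeff 0 = 0 := by
    push_cast
    rw [HahnSeries.coeff_sub, hfa]
    simp [c]
  obtain ⟨n, hn⟩ := dvd_pow_of_coeff hm hf0
  have h1 : f ∣ c ^ n - (c - f) ^ n := by
    have := sub_dvd_pow_sub_pow c (c - f) n
    simpa using this
  have h2 : f ∣ c ^ n := by simpa using dvd_add h1 hn
  exact isUnit_of_dvd_unit h2 (hc.pow n)

instance : IsLocalRing A := by
  apply IsLocalRing.of_isUnit_or_isUnit_one_sub_self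
  intro f
  by_cases h : (f : L).coeff 0 = 0
  · right
    apply isUnit_of_coeff
    push_cast
    simp [h]
  · exact Or.inl (isUnit_of_coeff h)

theorem coeff_of_mem {m : A} (h : m ∈ IsLocalRing.maximalIdeal A) : (m : L).coeff 0 = 0 := by
  by_contra h'
  exact (IsLocalRing.mem_maximalIdeal _).mp h (isUnit_of_coeff h')

theorem single_mem_max {e : ℚ} (he : 0 < e) :
    (⟨HahnSeries.single e (1 : ℂ), single_mem he.le⟩ : A) ∈ IsLocalRing.maximalIdeal A := by
  rw [IsLocalRing.mem_maximalIdeal]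
  intro hu
  obtain ⟨g, hg⟩ := hu.exists_left_inv
  have h1 : (g : L) * HahnSeries.single e (1 : ℂ) = 1 := congrArg Subtype.val hg
  have h2 := HahnSeries.coeff_mul_single_add (r := (1 : ℂ)) (x := (g : L)) (a := -e) (b := e)
  rw [h1, g.2.1 (-e) (by linarith)] at h2
  simp at h2

theorem dvd_of_forall {r s : A} (hs : s ≠ 0)
    (h : ∀ m ∈ IsLocalRing.maximalIdeal A, s ∣ r * m) : s ∣ r := by
  rw [dvd_iff hs]
  have key : ∀ e : ℚ, 0 < e → ((r : L) / s) * HahnSeries.single e (1 : ℂ) ∈ A := by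
    intro e he
    have := (dvd_iff hs).mp (h _ (single_mem_max he))
    push_cast at this
    rwa [mul_div_right_comm] at this
  refine ⟨fun q hq => ?_, fun q hq => ?_⟩
  · have := (key (-q / 2) (by linarith)).1 (q + -q / 2) (by linarith)
    rwa [HahnSeries.coeff_mul_single_add, mul_one] at this
  · have := (key ((1 - q) / 2) (by linarith)).2 (q + (1 - q) / 2) (by linarith)
    rwa [HahnSeries.coeff_mul_single_add, mul_one] at this

theorem one_div_max :
    1 / idealToFrac A (IsLocalRing.maximalIdeal A) = 1 := by
  apply le_antisymm
  · intro x hx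
    rw [Submodule.mem_div_iff_forall_mul_mem] at hx
    obtain ⟨r, s, hs, rfl⟩ := IsFractionRing.div_surjective (A := A) x
    have hs0 : s ≠ 0 := nonZeroDivisors.ne_zero hs
    have hs' : algebraMap A (FractionRing A) s ≠ 0 := by simpa using hs0
    obtain ⟨c, hc⟩ : s ∣ r := by
      refine dvd_of_forall hs0 fun m hm => ?_
      have := hx (algebraMap A _ m) (Submodule.mem_map.mpr ⟨m, hm, rfl⟩)
      obtain ⟨c, hc⟩ := Submodule.mem_one.mp this
      refine ⟨c, IsFractionRing.injective A (FractionRing A) ?_⟩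
      rw [map_mul, map_mul, hc]
      field_simp
    refine Submodule.mem_one.mpr ⟨c, ?_⟩
    rw [hc, map_mul]; field_simp
  · intro x hx
    obtain ⟨c, rfl⟩ := Submodule.mem_one.mp hx
    rw [Submodule.mem_div_iff_forall_mul_mem]
    rintro _ ⟨m, _, rfl⟩
    exact Submodule.mem_one.mpr ⟨c * m, by simp⟩

theorem not_divisorial : ¬ IsDivisorial A (IsLocalRing.maximalIdeal A) := by
  intro h
  unfold IsDivisorial at h
  rw [one_div_max] at h
  have h1 : (1 : FractionRing A) ∈ (1 / 1 : Submodule A (FractionRing A)) := by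
    rw [Submodule.mem_div_iff_forall_mul_mem]
    intro y hy; simpa using hy
  rw [h] at h1
  obtain ⟨m, hm, hm1⟩ := h1
  have : m = 1 := IsFractionRing.injective A (FractionRing A) (by simpa using hm1)
  subst this
  exact (IsLocalRing.mem_maximalIdeal _).mp hm isUnit_one

theorem not_cic : ¬ CompletelyIntegrallyClosed A := by
  intro h
  have hmem : ∀ z : ℂ, (HahnSeries.single (1 : ℚ) z : L) ∈ A := by
    intro z
    refine ⟨fun q hq => ?_, fun q hq => ?_⟩
    · rw [HahnSeries.coeff_single_of_ne (by linarith)]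
    · rw [HahnSeries.coeff_single_of_ne (by linarith)]; simp
  let b : A := ⟨HahnSeries.single (1 : ℚ) (1 : ℂ), hmem 1⟩
  let t : ℂ → A := fun z => ⟨HahnSeries.single (1 : ℚ) z, hmem z⟩
  have hb : b ≠ 0 := by
    intro h
    have h1 : (HahnSeries.single (1 : ℚ) (1 : ℂ) : L) = 0 := congrArg Subtype.val h
    simp at h1
  have hb' : algebraMap A (FractionRing A) b ≠ 0 := by simpa using hb
  obtain ⟨c, hc⟩ := h (algebraMap A _ (t Complex.I) / algebraMap A _ b) ⟨b, hb, fun n => by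
    refine ⟨t (Complex.I ^ n), ?_⟩
    rw [div_pow]
    field_simp
    rw [← map_pow, ← map_pow, ← map_mul, ← map_mul]
    congr 1
    apply Subtype.ext
    simp [b, t, HahnSeries.single_pow, HahnSeries.single_mul_single, add_comm]⟩
  rw [eq_div_iff hb', ← map_mul] at hc
  have h1 := congrArg Subtype.val (IsFractionRing.injective A (FractionRing A) hc)
  have h2 : (c : L) * HahnSeries.single (1 : ℚ) (1 : ℂ) = HahnSeries.single (1 : ℚ) Complex.I := h1
  have h3 := HahnSeries.coeff_mul_single_add (r := (1 : ℂ)) (x := (c : L)) (a := 0) (b := 1)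
  rw [h2, zero_add, HahnSeries.coeff_single_same, mul_one] at h3
  have h4 := c.2.2 0 one_pos
  rw [← h3] at h4
  simp at h4

theorem max_le_radical (x : A) (hx : x ≠ 0) :
    IsLocalRing.maximalIdeal A ≤ Ideal.radical (Ideal.span {x}) := by
  intro m hm
  obtain ⟨n, hn⟩ := dvd_pow_of_coeff (coeff_of_mem hm) hx
  exact ⟨n, Ideal.mem_span_singleton.mpr hn⟩

theorem dim_one : ringKrullDim A = 1 := by
  rw [ringKrullDim_eq_one_iff_of_isLocalRing_isDomain]
  refine ⟨fun hF => ?_, max_le_radical⟩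
  rw [IsLocalRing.isField_iff_maximalIdeal_eq] at hF
  have := single_mem_max (e := 1) one_pos
  rw [hF, Ideal.mem_bot] at this
  have h1 : (HahnSeries.single (1 : ℚ) (1 : ℂ) : L) = 0 := congrArg Subtype.val this
  simp at h1

end SDEx

/-- There exists an integral domain `R` that is not completely integrally closed and
has no strongly divisorial prime ideals; moreover `R` can be chosen quasilocal and
one-dimensional with its maximal ideal not divisorial. -/
theorem exists_non_cic_domain_without_strongly_divisorial_primes :
    ∃ (R : Type) (_ : CommRing R) (_ : IsDomain R) (_ : IsLocalRing R),
      ringKrullDim R = 1 ∧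
      ¬ CompletelyIntegrallyClosed R ∧
      (¬ ∃ P : Ideal R, P.IsPrime ∧ P ≠ ⊥ ∧ IsStrong R P ∧ IsDivisorial R P) ∧
      ¬ IsDivisorial R (IsLocalRing.maximalIdeal R) := by
  refine ⟨SDEx.A, inferInstance, inferInstance, inferInstance, SDEx.dim_one, SDEx.not_cic, ?_,
    SDEx.not_divisorial⟩
  rintro ⟨P, hP, hP0, -, hd⟩
  obtain ⟨x, hx, hx0⟩ := Submodule.exists_mem_ne_zero_of_ne_bot hP0
  have hle : IsLocalRing.maximalIdeal SDEx.A ≤ P :=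
    (SDEx.max_le_radical x hx0).trans
      (hP.radical_le_iff.mpr ((Ideal.span_singleton_le_iff_mem _).mpr hx))
  have : P = IsLocalRing.maximalIdeal SDEx.A :=
    le_antisymm (IsLocalRing.le_maximalIdeal hP.ne_top) hle
  rw [this] at hd
  exact SDEx.not_divisorial hd
end
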